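/- Let K be an algebraically closed field of characteristic zero. Let X₁ ⊆ X₂ and X₁ ⊆ X₃ be finite-rank root-closed subgroups of K^×, and let G₂ ⊆ X₂ and G₃ ⊆ X₃ be divisible subgroups with G₂ ∩ X₁ = G₃ ∩ X₁. Assume X₂ and X₃ are algebraically independent over X₁, i.e., every finite subset of X₂ which is algebraically independent over the subfield of K generated by X₁ remains algebraically independent over the subfield of K generated by X₃. Suppose X₁ is strong in X₂ with respect to G₂, i.e., for every finite-rank subgroup W of K^× with X₁ ⊆ W ⊆ X₂ one has 2·td(W) − rk(W ∩ G₂) ≥ 2·td(X₁) − rk(X₁ ∩ G₂). Then X₃ is strong in X₂·X₃ with respect to G₂·G₃, i.e., for every finite-rank subgroup W of K^× with X₃ ⊆ W ⊆ X₂·X₃ one has 2·td(W) − rk(W ∩ (G₂·G₃)) ≥ 2·td(X₃) − rk(X₃ ∩ (G₂·G₃)). (Asymmetric amalgamation: in the free amalgam over a strong base, the second factor is strong.) -/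

import Mathlib

noncomputable section

namespace GreenPoints

variable {K : Type*} [Field K] [CharZero K]

/-- The rank of a (multiplicative) subgroup of `Kˣ`: the ℤ-module rank of the
underlying abelian group, i.e. the dimension over ℚ of `S ⊗ ℚ`. -/
def grpRank (S : Subgroup Kˣ) : Cardinal := Module.rank ℤ (Additive S)

/-- A subgroup of `Kˣ` has finite rank. -/
def FiniteRank (S : Subgroup Kˣ) : Prop := grpRank S < Cardinal.aleph0

/-- The transcendence degree over ℚ of the subfield of `K` generated by a subset `s` of `K`:
the supremum of the cardinalities of subsets of `s` that are algebraically
independent over ℚ. -/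
def tdSet (s : Set K) : Cardinal :=
  ⨆ t : {t : Set K // t ⊆ s ∧ AlgebraicIndependent ℚ ((↑) : t → K)}, Cardinal.mk t.1

/-- The transcendence degree over ℚ of the subfield of `K` generated by a subgroup of `Kˣ`. -/
def td (S : Subgroup Kˣ) : Cardinal := tdSet (Units.val '' (S : Set Kˣ))

/-- The predimension `δ(S) = 2·td(S) − rk(S ∩ G)` (with respect to the subgroup `G`
of green points). -/
def delta (G S : Subgroup Kˣ) : ℤ :=
  2 * ((td S).toNat : ℤ) - ((grpRank (S ⊓ G)).toNat : ℤ)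

/-- `Y` is strong in `T` (with respect to `G`): `δ(W) ≥ δ(Y)` for every finite-rank
subgroup `W` with `Y ⊆ W ⊆ T`. -/
def StrongIn (G Y T : Subgroup Kˣ) : Prop :=
  ∀ W : Subgroup Kˣ, FiniteRank W → Y ≤ W → W ≤ T → delta G Y ≤ delta G W

/-- `Y` is strong: strong in `Kˣ`. -/
def Strong (G Y : Subgroup Kˣ) : Prop := StrongIn G Y ⊤

/-- A subgroup `S` of `Kˣ` is root-closed: `x ∈ S` whenever `x^n ∈ S` for some `n ≥ 1`. -/
def RootClosed (S : Subgroup Kˣ) : Prop :=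
  ∀ (x : Kˣ) (n : ℕ), 1 ≤ n → x ^ n ∈ S → x ∈ S

/-- The subfield of `K` generated by a subgroup of `Kˣ`. -/
def fieldOf (S : Subgroup Kˣ) : Subfield K := Subfield.closure (Units.val '' (S : Set Kˣ))

/-- The subgroup as a ℤ-submodule of `Additive Kˣ`. -/
def toSub (S : Subgroup Kˣ) : Submodule ℤ (Additive Kˣ) :=
  AddSubgroup.toIntSubmodule (Subgroup.toAddSubgroup S)

theorem grpRank_eq (S : Subgroup Kˣ) : grpRank S = Module.rank ℤ (toSub S) := rfl

theorem toSub_mono {S T : Subgroup Kˣ} (h : S ≤ T) : toSub S ≤ toSub T := fun _ hx => h hx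

theorem grpRank_mono {S T : Subgroup Kˣ} (h : S ≤ T) : grpRank S ≤ grpRank T := by
  rw [grpRank_eq, grpRank_eq]
  exact Submodule.rank_mono (toSub_mono h)

theorem grpRank_submod (A B : Subgroup Kˣ) :
    grpRank (A ⊔ B) + grpRank (A ⊓ B) = grpRank A + grpRank B := by
  have h1 : toSub (A ⊔ B) = toSub A ⊔ toSub B := by simp [toSub]
  have h2 : toSub (A ⊓ B) = toSub A ⊓ toSub B := by simp [toSub]
  rw [grpRank_eq, grpRank_eq, grpRank_eq A, grpRank_eq B, h1, h2]
  exact Submodule.rank_sup_add_rank_inf_eq _ _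

open MvPolynomial in
theorem mk_le_grpRank (S : Subgroup Kˣ) (t : Set K) (ht : t ⊆ Units.val '' (S : Set Kˣ))
    (hi : AlgebraicIndependent ℚ ((↑) : t → K)) : Cardinal.mk t ≤ grpRank S := by
  classical
  choose f hf hfx using fun x : t => ht x.2
  let v : t → Additive S := fun x => Additive.ofMul ⟨f x, hf x⟩
  have hv : LinearIndependent ℤ v := by
    rw [linearIndependent_iff']
    intro s g hg i his
    have h1 : ∏ j ∈ s, f j ^ g j = 1 := by
      have := congrArg (fun z : Additive S => ((Additive.toMul z : S) : Kˣ)) hg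
      simpa [v, toMul_sum] using this
    have h2 : ∏ j ∈ s, f j ^ (g j).toNat = ∏ j ∈ s, f j ^ (-g j).toNat := by
      rw [← div_eq_one, ← Finset.prod_div_distrib, ← h1]
      refine Finset.prod_congr rfl fun j _ => ?_
      rw [← zpow_natCast, ← zpow_natCast, div_eq_mul_inv, ← zpow_sub]
      congr 1
      omega
    have h3 : ∏ j ∈ s, (j : K) ^ (g j).toNat = ∏ j ∈ s, (j : K) ^ (-g j).toNat := by
      have := congrArg Units.val h2
      simpa [Units.coe_prod, hfx] using this
    have h4 : (∏ j ∈ s, (X j : MvPolynomial t ℚ) ^ (g j).toNat) =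
        ∏ j ∈ s, (X j : MvPolynomial t ℚ) ^ (-g j).toNat := by
      apply hi
      simpa using h3
    have key : ∀ e : t → ℕ, (∏ j ∈ s, (X j : MvPolynomial t ℚ) ^ e j) =
        monomial (∑ j ∈ s, Finsupp.single j (e j)) 1 := by
      intro e
      rw [monomial_sum_one]
      exact Finset.prod_congr rfl fun j _ => by rw [X_pow_eq_monomial]
    rw [key, key] at h4
    have h5 := monomial_left_injective (R := ℚ) one_ne_zero h4
    have h6 := DFunLike.congr_fun h5 i
    simp [Finsupp.finsetSum_apply, Finsupp.single_apply, his] at h6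
    omega
  exact hv.cardinal_le_rank

theorem td_le_grpRank (S : Subgroup Kˣ) : td S ≤ grpRank S :=
  ciSup_le' fun t => mk_le_grpRank S t.1 t.2.1 t.2.2

theorem le_td (S : Subgroup Kˣ) (t : Set K) (ht : t ⊆ Units.val '' (S : Set Kˣ))
    (hi : AlgebraicIndependent ℚ ((↑) : t → K)) : Cardinal.mk t ≤ td S :=
  le_ciSup_of_le Cardinal.bddAbove_of_small
    (⟨t, ht, hi⟩ : {t : Set K // t ⊆ Units.val '' (S : Set Kˣ) ∧
      AlgebraicIndependent ℚ ((↑) : t → K)}) le_rfl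

theorem td_eq_of_isBasis (S : Subgroup Kˣ) (B : Set K)
    (hB : (AlgebraicIndependent.matroid ℚ K).IsBasis B (Units.val '' (S : Set Kˣ))) :
    td S = Cardinal.mk B := by
  apply le_antisymm
  · refine ciSup_le' fun t => ?_
    have ht : (AlgebraicIndependent.matroid ℚ K).Indep t.1 := t.2.2
    obtain ⟨B', hB', htB'⟩ := ht.subset_isBasis_of_subset t.2.1
    exact (Cardinal.mk_le_mk_of_subset htB').trans (hB'.cardinalMk_eq hB).le
  · exact le_td S B hB.subset hB.indep

theorem indep_over_fieldOf (S : Subgroup Kˣ) (B : Set K) {ι : Type*} (y : ι → K)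
    (hB : ∀ a ∈ Units.val '' (S : Set Kˣ), IsAlgebraic (Algebra.adjoin ℚ B) a)
    (hy : AlgebraicIndependent (Algebra.adjoin ℚ B) y) :
    AlgebraicIndependent (fieldOf S) y := by
  have h1 := hy.subalgebraAlgebraicClosure
  have hle : ∀ a ∈ fieldOf S, a ∈ Subalgebra.algebraicClosure (Algebra.adjoin ℚ B) K := by
    intro a ha
    change IsAlgebraic _ a
    induction ha using Subfield.closure_induction with
    | mem x hx => exact hB x hx
    | one => exact isAlgebraic_one
    | add x y _ _ hx hy => exact hx.add hy
    | neg x _ hx => exact hx.neg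
    | inv x _ hx => exact hx.inv
    | mul x y _ _ hx hy => exact hx.mul hy
  let f : fieldOf S →+* Subalgebra.algebraicClosure (Algebra.adjoin ℚ B) K :=
    (fieldOf S).subtype.codRestrict _ (fun x => hle x x.2)
  let _ : Algebra (fieldOf S) (Subalgebra.algebraicClosure (Algebra.adjoin ℚ B) K) := f.toAlgebra
  have : IsScalarTower (fieldOf S) (Subalgebra.algebraicClosure (Algebra.adjoin ℚ B) K) K :=
    .of_algebraMap_eq fun x => rfl
  exact h1.restrictScalars f.injective

theorem td_amalg (X₁ X₂ X₃ V W : Subgroup Kˣ) (h1V : X₁ ≤ V) (hV2 : V ≤ X₂)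
    (hVW : V ≤ W) (h3W : X₃ ≤ W) (hfr : FiniteRank V)
    (hindep : ∀ s : Finset Kˣ, (↑s : Set Kˣ) ⊆ (X₂ : Set Kˣ) →
      AlgebraicIndependent (fieldOf X₁) (fun x : s => ((x : Kˣ) : K)) →
      AlgebraicIndependent (fieldOf X₃) (fun x : s => ((x : Kˣ) : K))) :
    td V + td X₃ ≤ td W + td X₁ := by
  classical
  let M := AlgebraicIndependent.matroid ℚ K
  obtain ⟨B₁, hB₁⟩ := M.exists_isBasis (Units.val '' (X₁ : Set Kˣ)) (Set.subset_univ _)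
  obtain ⟨B₃, hB₃⟩ := M.exists_isBasis (Units.val '' (X₃ : Set Kˣ)) (Set.subset_univ _)
  obtain ⟨B₂, hB₂, h12⟩ := hB₁.indep.subset_isBasis_of_subset
    (hB₁.subset.trans (Set.image_mono h1V) : B₁ ⊆ Units.val '' (V : Set Kˣ)) (Set.subset_univ _)
  have hfin : B₂.Finite := by
    rw [← Cardinal.lt_aleph0_iff_set_finite, ← td_eq_of_isBasis V B₂ hB₂]
    exact (td_le_grpRank V).trans_lt hfr
  rw [td_eq_of_isBasis V B₂ hB₂, td_eq_of_isBasis X₃ B₃ hB₃, td_eq_of_isBasis X₁ B₁ hB₁]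
  have hpre : (Units.val ⁻¹' (B₂ \ B₁) : Set Kˣ).Finite :=
    (hfin.subset Set.sdiff_subset).preimage Units.val_injective.injOn
  let s : Finset Kˣ := hpre.toFinset
  have hs : ∀ x : Kˣ, x ∈ s ↔ (x : K) ∈ B₂ ∧ (x : K) ∉ B₁ := by
    intro x; simp [s]
  have hsV : ∀ x ∈ s, x ∈ V := by
    intro x hx
    obtain ⟨y, hy, hyx⟩ := hB₂.subset ((hs x).1 hx).1
    rwa [← Units.ext hyx]
  have hB₂i : AlgebraicIndependent ℚ ((↑) : B₂ → K) := hB₂.indep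
  have hi1 : AlgebraicIndependent (Algebra.adjoin ℚ B₁) (fun x : s => ((x : Kˣ) : K)) := by
    have := hB₂i.adjoin_of_disjoint (s := Subtype.val ⁻¹' B₁) (t := (Subtype.val ⁻¹' B₁)ᶜ)
      disjoint_compl_right
    rw [Subtype.image_preimage_coe, Set.inter_eq_right.2 h12] at this
    refine this.comp (fun x : s => ⟨⟨((x : Kˣ) : K), ((hs x).1 x.2).1⟩, ((hs x).1 x.2).2⟩) ?_
    intro x y hxy
    have : ((x : Kˣ) : K) = ((y : Kˣ) : K) := congrArg (fun z => ((z : B₂) : K)) (congrArg Subtype.val hxy)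
    exact Subtype.ext (Units.ext this)
  have hi2 := indep_over_fieldOf X₁ B₁ _
    (AlgebraicIndependent.matroid_isBasis_iff.1 hB₁).2.2 hi1
  have hi3 := hindep s (fun x hx => hV2 (hsV x hx)) hi2
  have hB₃i : AlgebraicIndependent ℚ ((↑) : B₃ → K) := hB₃.indep
  have hi4 := hB₃i.sumElim_of_tower (S := fieldOf X₃) (by
    rintro _ ⟨x, rfl⟩
    exact ⟨⟨x, Subfield.subset_closure (hB₃.subset x.2)⟩, rfl⟩) hi3
  have h5 := le_td W _ (by
    rintro _ ⟨x | x, rfl⟩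
    · exact ⟨x, hVW (hsV x x.2), rfl⟩
    · exact Set.image_mono h3W (hB₃.subset x.2)) hi4.to_subtype_range
  rw [Cardinal.mk_range_eq _ hi4.injective, Cardinal.mk_sum, Cardinal.lift_id, Cardinal.lift_id] at h5
  have h6 : Cardinal.mk B₂ ≤ Cardinal.mk s + Cardinal.mk B₁ := by
    have : B₂ ⊆ (Units.val '' (s : Set Kˣ)) ∪ B₁ := by
      intro x hx
      by_cases hx1 : x ∈ B₁
      · exact Or.inr hx1
      · obtain ⟨y, hy, rfl⟩ := hB₂.subset hx
        exact Or.inl ⟨y, (hs y).2 ⟨hx, hx1⟩, rfl⟩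
    refine (Cardinal.mk_le_mk_of_subset this).trans ((Cardinal.mk_union_le _ _).trans ?_)
    gcongr
    exact Cardinal.mk_image_le
  calc _ ≤ (Cardinal.mk s + Cardinal.mk B₁) + Cardinal.mk B₃ := by gcongr
    _ = (Cardinal.mk s + Cardinal.mk B₃) + Cardinal.mk B₁ := by ring
    _ ≤ _ := by gcongr

theorem toNat_add_le {a b c d : Cardinal} (h : a + b ≤ c + d)
    (ha : a < Cardinal.aleph0) (hb : b < Cardinal.aleph0) (hc : c < Cardinal.aleph0)
    (hd : d < Cardinal.aleph0) : a.toNat + b.toNat ≤ c.toNat + d.toNat := by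
  rw [← Cardinal.toNat_add ha hb, ← Cardinal.toNat_add hc hd]
  exact Cardinal.toNat_le_toNat h (Cardinal.add_lt_aleph0 hc hd)

/-- Asymmetric amalgamation: in the free amalgam over a strong base, the second factor is
strong. If `X₁ ⊆ X₂`, `X₁ ⊆ X₃` are finite-rank root-closed subgroups of an algebraically
closed field `K` of characteristic zero, `G₂ ⊆ X₂` and `G₃ ⊆ X₃` are divisible subgroups
with `G₂ ∩ X₁ = G₃ ∩ X₁`, `X₂` and `X₃` are algebraically independent over `X₁`, and `X₁`
is strong in `X₂` with respect to `G₂`, then `X₃` is strong in `X₂·X₃` with respect to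
`G₂·G₃`. -/
theorem asymmetric_amalgamation {K : Type*} [Field K] [IsAlgClosed K] [CharZero K]
    (X₁ X₂ X₃ : Subgroup Kˣ) (h12 : X₁ ≤ X₂) (h13 : X₁ ≤ X₃)
    (hfr1 : FiniteRank X₁) (hfr2 : FiniteRank X₂) (hfr3 : FiniteRank X₃)
    (hrc1 : RootClosed X₁) (hrc2 : RootClosed X₂) (hrc3 : RootClosed X₃)
    (G₂ G₃ : Subgroup Kˣ) (hG2 : G₂ ≤ X₂) (hG3 : G₃ ≤ X₃)
    (hG2div : ∀ x ∈ G₂, ∀ n : ℕ, 1 ≤ n → ∃ y ∈ G₂, y ^ n = x)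
    (hG3div : ∀ x ∈ G₃, ∀ n : ℕ, 1 ≤ n → ∃ y ∈ G₃, y ^ n = x)
    (hGinter : G₂ ⊓ X₁ = G₃ ⊓ X₁)
    (hindep : ∀ s : Finset Kˣ, (↑s : Set Kˣ) ⊆ (X₂ : Set Kˣ) →
      AlgebraicIndependent (fieldOf X₁) (fun x : s => ((x : Kˣ) : K)) →
      AlgebraicIndependent (fieldOf X₃) (fun x : s => ((x : Kˣ) : K)))
    (hstrong : ∀ W : Subgroup Kˣ, FiniteRank W → X₁ ≤ W → W ≤ X₂ →
      delta G₂ X₁ ≤ delta G₂ W) :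
    ∀ W : Subgroup Kˣ, FiniteRank W → X₃ ≤ W → W ≤ X₂ ⊔ X₃ →
      delta (G₂ ⊔ G₃) X₃ ≤ delta (G₂ ⊔ G₃) W := by
  intro W hW h3W hW23
  have hV : FiniteRank (W ⊓ X₂) := (grpRank_mono inf_le_left).trans_lt hW
  have h1V : X₁ ≤ W ⊓ X₂ := le_inf (h13.trans h3W) h12
  have hst := hstrong (W ⊓ X₂) hV h1V inf_le_right
  have htd := td_amalg X₁ X₂ X₃ (W ⊓ X₂) W h1V inf_le_right inf_le_left h3W hV hindep
  have hrk : grpRank (W ⊓ (G₂ ⊔ G₃)) + grpRank (X₁ ⊓ G₂) ≤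
      grpRank (W ⊓ X₂ ⊓ G₂) + grpRank (X₃ ⊓ (G₂ ⊔ G₃)) := by
    rw [← grpRank_submod (W ⊓ X₂ ⊓ G₂)]
    refine add_le_add (grpRank_mono ?_) (grpRank_mono ?_)
    · rintro x ⟨hxW, hx⟩
      obtain ⟨g, hg, h, hh, rfl⟩ := Subgroup.mem_sup.1 hx
      have hhW : h ∈ W := h3W (hG3 hh)
      have hgW : g ∈ W := by
        have := W.mul_mem hxW (W.inv_mem hhW)
        simpa using this
      exact Subgroup.mul_mem_sup ⟨⟨hgW, hG2 hg⟩, hg⟩ ⟨hG3 hh, Subgroup.mem_sup_right hh⟩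
    · rintro x ⟨hx1, hx⟩
      exact ⟨⟨h1V hx1, hx⟩, h13 hx1, Subgroup.mem_sup_left hx⟩
  have e1 := toNat_add_le htd ((td_le_grpRank _).trans_lt hV) ((td_le_grpRank _).trans_lt hfr3)
    ((td_le_grpRank _).trans_lt hW) ((td_le_grpRank _).trans_lt hfr1)
  have e2 := toNat_add_le hrk ((grpRank_mono inf_le_left).trans_lt hW)
    ((grpRank_mono inf_le_left).trans_lt hfr1) ((grpRank_mono inf_le_left).trans_lt hV)
    ((grpRank_mono inf_le_left).trans_lt hfr3)
  unfold delta at hst ⊢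
  omega

end GreenPoints

end
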